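/- arXiv:1910.08276 — 8 statements merged into one kernel-verified Lean document; each statement's English description precedes it below -/
import Mathlib

section
/- Let 𝒳, 𝒴 be finite sets, p a joint pmf on 𝒳×𝒴, f : 𝒳×𝒴 → ℝ^d, and ε ≥ 0. Then R(ε) = H_{G_ε}(X|Y): the infimum of I(U;X|Y) over all finite auxiliary alphabets 𝒰 and joint pmfs p(u,x,y) = p(x,y)·r(u|x) admitting a reconstruction function g : 𝒰×𝒴 → ℝ^d with ‖g(u,y) − f(x,y)‖ ≤ ε whenever p(u,x,y) > 0, equals the minimum of I(W;X|Y) over all random variables W taking values in the set Γ(G_ε) of hyperedges of the ε-characteristic hypergraph with joint pmf p(w,x,y) = p(x,y)·r(w|x) satisfying r(w|x) = 0 unless x ∈ w. -/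
open scoped BigOperators

noncomputable section

/-- `p` is a joint probability mass function on `X × Y`. -/
def IsJointPMF {X Y : Type*} [Fintype X] [Fintype Y] (p : X → Y → ℝ) : Prop :=
  (∀ x y, 0 ≤ p x y) ∧ ∑ x, ∑ y, p x y = 1

/-- `r` is a conditional pmf `r(u|x)`. -/
def IsCondPMF {X U : Type*} [Fintype U] (r : X → U → ℝ) : Prop :=
  ∀ x, (∀ u, 0 ≤ r x u) ∧ ∑ u, r x u = 1

/-- `S` is a hyperedge of the ε-characteristic hypergraph `G_ε`: for every `y`
there is a point `z` within distance `ε` of all `f x y` with `x ∈ S`, `p x y > 0`. -/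
def IsHyperedge {X Y E : Type*} [NormedAddCommGroup E]
    (p : X → Y → ℝ) (f : X → Y → E) (ε : ℝ) (S : Finset X) : Prop :=
  S.Nonempty ∧ ∀ y : Y, ∃ z : E, ∀ x ∈ S, 0 < p x y → ‖f x y - z‖ ≤ ε

/-- Conditional mutual information `I(W;X|Y)` of a joint pmf `q` on `W × X × Y`
(in bits; terms with zero probability vanish since `0 * log(...) = 0`). -/
noncomputable def condMI {W X Y : Type*} [Fintype W] [Fintype X] [Fintype Y]
    (q : W → X → Y → ℝ) : ℝ :=
  ∑ w, ∑ x, ∑ y, q w x y *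
    Real.logb 2 ((q w x y * (∑ w', ∑ x', q w' x' y)) /
      ((∑ x', q w x' y) * (∑ w', q w' x y)))

/-- The log-sum inequality. -/
theorem sum_mul_logb_div_sum_le {ι : Type*} (s : Finset ι) (a b : ι → ℝ)
    (ha : ∀ i, 0 ≤ a i) (hb : ∀ i, 0 ≤ b i) (hab : ∀ i, b i = 0 → a i = 0) :
    (∑ i ∈ s, a i) * Real.logb 2 ((∑ i ∈ s, a i) / ∑ i ∈ s, b i) ≤
      ∑ i ∈ s, a i * Real.logb 2 (a i / b i) := by
  simp only [Real.logb, ← mul_div_assoc]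
  rw [← Finset.sum_div]
  refine div_le_div_of_nonneg_right ?_ (Real.log_nonneg one_le_two)
  set A := ∑ i ∈ s, a i with hA
  set B := ∑ i ∈ s, b i with hB
  rcases (show 0 ≤ A from Finset.sum_nonneg fun i _ => ha i).eq_or_lt with hA0 | hA0
  · have h : ∀ i ∈ s, a i = 0 := (Finset.sum_eq_zero_iff_of_nonneg fun i _ => ha i).1 hA0.symm
    rw [← hA0, zero_mul]
    exact (Finset.sum_eq_zero fun i hi => by rw [h i hi, zero_mul]).ge
  have hB0 : 0 < B := by
    refine (show 0 ≤ B from Finset.sum_nonneg fun i _ => hb i).lt_of_ne fun h0 => hA0.ne' ?_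
    have h := (Finset.sum_eq_zero_iff_of_nonneg fun i _ => hb i).1 h0.symm
    exact Finset.sum_eq_zero fun i hi => hab i (h i hi)
  have key : ∀ i ∈ s, a i * Real.log (A / B) + (a i - b i * (A / B)) ≤
      a i * Real.log (a i / b i) := by
    intro i _
    rcases (ha i).eq_or_lt with h0 | h0
    · rw [← h0]
      have : 0 ≤ b i * (A / B) := mul_nonneg (hb i) (div_pos hA0 hB0).le
      linarith
    · have hbi : 0 < b i := (hb i).lt_of_ne fun h => h0.ne' (hab i h.symm)
      have hlog := Real.one_sub_inv_le_log_of_pos (div_pos (div_pos h0 hbi) (div_pos hA0 hB0))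
      rw [Real.log_div (div_pos h0 hbi).ne' (div_pos hA0 hB0).ne'] at hlog
      have hmul := mul_le_mul_of_nonneg_left hlog h0.le
      have : a i * (1 - (a i / b i / (A / B))⁻¹) = a i - b i * (A / B) := by
        field_simp
      linarith
  have hsum := Finset.sum_le_sum key
  rw [Finset.sum_add_distrib, Finset.sum_sub_distrib, ← Finset.sum_mul, ← Finset.sum_mul,
    ← hA, ← hB, mul_div_cancel₀ A hB0.ne'] at hsum
  linarith

/-- The data processing inequality for conditional mutual information. -/
theorem condMI_map_le {U W X Y : Type*} [Fintype U] [Fintype W] [DecidableEq W] [Fintype X]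
    [Fintype Y] (φ : U → W) (q : U → X → Y → ℝ) (hq : ∀ u x y, 0 ≤ q u x y) :
    condMI (fun w x y => ∑ u with φ u = w, q u x y) ≤ condMI q := by
  have fiber (g : U → ℝ) : ∑ w, ∑ u with φ u = w, g u = ∑ u, g u :=
    Finset.sum_fiberwise _ _ _
  have hX (w : W) (y : Y) :
      ∑ x, ∑ u with φ u = w, q u x y = ∑ u with φ u = w, ∑ x, q u x y := Finset.sum_comm
  unfold condMI
  simp only [hX, fiber]
  refine le_of_le_of_eq ?_ (fiber _)
  refine Finset.sum_le_sum fun w _ => ?_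
  refine le_of_le_of_eq ?_ Finset.sum_comm
  refine Finset.sum_le_sum fun x _ => ?_
  refine le_of_le_of_eq ?_ Finset.sum_comm
  refine Finset.sum_le_sum fun y _ => ?_
  set T := ∑ u, ∑ x, q u x y
  set N := ∑ u, q u x y
  have hM (u : U) : 0 ≤ ∑ x, q u x y := Finset.sum_nonneg fun x _ => hq u x y
  have hN : 0 ≤ N := Finset.sum_nonneg fun u _ => hq u x y
  have hT : 0 ≤ T := Finset.sum_nonneg fun u _ => hM u
  have hqM (u : U) : q u x y ≤ ∑ x, q u x y :=
    Finset.single_le_sum (f := fun x => q u x y) (fun x _ => hq u x y) (Finset.mem_univ x)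
  have hqN (u : U) : q u x y ≤ N :=
    Finset.single_le_sum (f := fun u => q u x y) (fun u _ => hq u x y) (Finset.mem_univ u)
  have hMT (u : U) : ∑ x, q u x y ≤ T :=
    Finset.single_le_sum (f := fun u => ∑ x, q u x y) (fun u _ => hM u) (Finset.mem_univ u)
  have h := sum_mul_logb_div_sum_le {u | φ u = w} (fun u => q u x y)
    (fun u => (∑ x, q u x y) * N / T) (fun u => hq u x y)
    (fun u => div_nonneg (mul_nonneg (hM u) hN) hT) fun u h0 => by
      refine le_antisymm ?_ (hq u x y)
      rcases div_eq_zero_iff.1 h0 with h0 | h0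
      · rcases mul_eq_zero.1 h0 with h0 | h0
        · exact (hqM u).trans h0.le
        · exact (hqN u).trans h0.le
      · exact (hqM u).trans ((hMT u).trans h0.le)
  simpa only [← Finset.sum_div, ← Finset.sum_mul, div_div_eq_mul_div] using h

theorem condMI_comp_equiv {U W X Y : Type*} [Fintype U] [Fintype W] [Fintype X] [Fintype Y]
    (e : U ≃ W) (q : W → X → Y → ℝ) : condMI (fun u x y => q (e u) x y) = condMI q := by
  unfold condMI
  have h₁ (y : Y) : ∑ u, ∑ x, q (e u) x y = ∑ w, ∑ x, q w x y :=
    e.sum_comp fun w => ∑ x, q w x y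
  have h₂ (x : X) (y : Y) : ∑ u, q (e u) x y = ∑ w, q w x y := e.sum_comp fun w => q w x y
  simp only [h₁, h₂]
  exact e.sum_comp (fun w => ∑ x, ∑ y, q w x y *
    Real.logb 2 ((q w x y * ∑ w', ∑ x', q w' x' y) / ((∑ x', q w x' y) * ∑ w', q w' x y)))

theorem Real.sInf_eq_of_subset_of_forall_exists_le {A B : Set ℝ} (hBA : B ⊆ A)
    (hAB : ∀ a ∈ A, ∃ b ∈ B, b ≤ a) : sInf A = sInf B := by
  rcases A.eq_empty_or_nonempty with rfl | ⟨a, ha⟩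
  · rw [Set.subset_empty_iff.1 hBA]
  obtain ⟨b, hb, -⟩ := hAB a ha
  by_cases hA : BddBelow A
  · refine le_antisymm (csInf_le_csInf hA ⟨b, hb⟩ hBA) (le_csInf ⟨a, ha⟩ fun c hc => ?_)
    obtain ⟨c', hc', hle⟩ := hAB c hc
    exact (csInf_le (hA.mono hBA) hc').trans hle
  · have hB : ¬ BddBelow B := by
      rintro ⟨m, hm⟩
      refine hA ⟨m, fun c hc => ?_⟩
      obtain ⟨c', hc', hle⟩ := hAB c hc
      exact (hm hc').trans hle
    rw [Real.sInf_of_not_bddBelow hA, Real.sInf_of_not_bddBelow hB]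

/-- **Theorem 2 (R(ε) = H_{G_ε}(X|Y))**: the infimum of `I(U;X|Y)` over auxiliary
variables `U` (Markov `U–X–Y`) admitting an ε-accurate reconstruction function `g`
equals the infimum of `I(W;X|Y)` over variables `W` supported on hyperedges of the
ε-characteristic hypergraph containing `X`. -/
theorem stmt_0 {X Y : Type*} [Fintype X] [Fintype Y] [DecidableEq X] {d : ℕ}
    (p : X → Y → ℝ) (f : X → Y → EuclideanSpace ℝ (Fin d)) (ε : ℝ)
    (hp : IsJointPMF p) (hε : 0 ≤ ε) :
    sInf {i : ℝ | ∃ (n : ℕ) (r : X → Fin n → ℝ), IsCondPMF r ∧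
        (∃ g : Fin n → Y → EuclideanSpace ℝ (Fin d),
          ∀ u x y, 0 < p x y * r x u → ‖g u y - f x y‖ ≤ ε) ∧
        i = condMI (fun u x y => p x y * r x u)} =
    sInf {i : ℝ | ∃ r : X → Finset X → ℝ, IsCondPMF r ∧
        (∀ x w, 0 < r x w → x ∈ w ∧ IsHyperedge p f ε w) ∧
        i = condMI (fun w x y => p x y * r x w)} := by
  refine Real.sInf_eq_of_subset_of_forall_exists_le ?_ ?_
  · rintro i ⟨r, hr, hrw, rfl⟩
    let e := (Fintype.equivFin (Finset X)).symm
    refine ⟨Fintype.card (Finset X), fun x u => r x (e u),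
      fun x => ⟨fun u => (hr x).1 _, (e.sum_comp (r x)).trans (hr x).2⟩, ?_,
      (condMI_comp_equiv e fun w x y => p x y * r x w).symm⟩
    have hg (w : Finset X) (y : Y) : ∃ z : EuclideanSpace ℝ (Fin d),
        IsHyperedge p f ε w → ∀ x ∈ w, 0 < p x y → ‖f x y - z‖ ≤ ε := by
      by_cases hw : IsHyperedge p f ε w
      · exact (hw.2 y).imp fun z hz _ => hz
      · exact ⟨0, fun h => absurd h hw⟩
    choose g hg using hg
    refine ⟨fun u => g (e u), fun u x y hpos => ?_⟩
    have hpx : 0 < p x y := pos_of_mul_pos_left hpos ((hr x).1 _)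
    obtain ⟨hx, hw⟩ := hrw x (e u) (pos_of_mul_pos_right hpos (hp.1 x y))
    rw [norm_sub_rev]
    exact hg _ y hw x hx hpx
  · rintro i ⟨n, r, hr, ⟨g, hg⟩, rfl⟩
    let φ : Fin n → Finset X := fun u => {x | 0 < r x u}
    refine ⟨_, ⟨fun x w => ∑ u with φ u = w, r x u, fun x =>
      ⟨fun w => Finset.sum_nonneg fun u _ => (hr x).1 u,
        (Finset.sum_fiberwise _ _ _).trans (hr x).2⟩, fun x w hpos => ?_, rfl⟩, ?_⟩
    · obtain ⟨u, hu, hru⟩ := Finset.exists_lt_of_sum_lt (s := {u | φ u = w}) (f := fun _ => (0 : ℝ))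
        (g := r x) (by simpa using hpos)
      obtain rfl : φ u = w := (Finset.mem_filter.1 hu).2
      have hx : x ∈ φ u := by simpa [φ] using hru
      refine ⟨hx, ⟨x, hx⟩, fun y => ⟨g u y, fun x' hx' hpx' => ?_⟩⟩
      rw [norm_sub_rev]
      exact hg u x' y (mul_pos hpx' (by simpa [φ] using hx'))
    · simp only [Finset.mul_sum]
      exact condMI_map_le φ (fun u x y => p x y * r x u)
        fun u x y => mul_nonneg (hp.1 x y) ((hr x).1 u)
end
end

section
/- Let 𝒳, 𝒴, 𝒰 be finite sets, p a joint pmf on 𝒰×𝒳×𝒴 of the form p(u,x,y) = p(x,y)·r(u|x) (so U–X–Y is a Markov chain), f : 𝒳×𝒴 → ℝ^d, and ε ≥ 0. Suppose there is a function g : 𝒰×𝒴 → ℝ^d with ‖g(u,y) − f(x,y)‖ ≤ ε whenever p(u,x,y) > 0. For each u with p(u) > 0, define w(u) = {x ∈ 𝒳 : p(u,x) > 0}. Then: (i) x ∈ w(u) whenever p(u,x) > 0, and (ii) w(u) is a hyperedge of the ε-characteristic hypergraph G_ε for every u with p(u) > 0. -/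
open scoped BigOperators Classical

noncomputable section

/-- Given Markov chain `U–X–Y` with `p(u,x,y) = p(x,y)·r(u|x)` and a reconstruction
`g` with `‖g(u,y) − f(x,y)‖ ≤ ε` whenever `p(u,x,y) > 0`, the set
`w(u) = {x : p(u,x) > 0}` satisfies: (i) `x ∈ w(u)` whenever `p(u,x) > 0`, and
(ii) `w(u)` is a hyperedge of `G_ε` for every `u` with `p(u) > 0`. -/
theorem stmt_2 {X Y U : Type*} [Fintype X] [Fintype Y] [Fintype U] [DecidableEq X] {d : ℕ}
    (p : X → Y → ℝ) (f : X → Y → EuclideanSpace ℝ (Fin d)) (ε : ℝ)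
    (r : X → U → ℝ) (g : U → Y → EuclideanSpace ℝ (Fin d))
    (hp : IsJointPMF p) (hε : 0 ≤ ε) (hr : IsCondPMF r)
    (hg : ∀ u x y, 0 < p x y * r x u → ‖g u y - f x y‖ ≤ ε)
    (w : U → Finset X)
    (hw : ∀ u, w u = Finset.univ.filter (fun x => 0 < (∑ y, p x y) * r x u)) :
    (∀ u x, 0 < (∑ y, p x y) * r x u → x ∈ w u) ∧
    (∀ u, 0 < ∑ x, (∑ y, p x y) * r x u → IsHyperedge p f ε (w u)) := by
  refine ⟨fun u x hx => by simpa [hw] using hx, fun u hu => ⟨?_, fun y => ⟨g u y, ?_⟩⟩⟩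
  · obtain ⟨x, -, hx⟩ := Finset.exists_lt_of_sum_lt
      (show ∑ _x : X, (0 : ℝ) < ∑ x, (∑ y, p x y) * r x u by simpa using hu)
    exact ⟨x, by simpa [hw] using hx⟩
  · intro x hx hxy
    have hpos : 0 < (∑ y, p x y) * r x u := by simpa [hw] using hx
    have hru : 0 < r x u :=
      pos_of_mul_pos_right hpos (Finset.sum_nonneg fun y _ => hp.1 x y)
    rw [norm_sub_rev]
    exact hg u x y (mul_pos hxy hru)
end
end

section
/- Let 𝒳, 𝒴 be finite sets, p a joint pmf on 𝒳×𝒴, and f : 𝒳×𝒴 → 𝒵 a function into a finite set 𝒵 ⊂ ℝ^d. Assume Condition 1: for every y ∈ 𝒴 and x, x' ∈ 𝒳, if f(x,y) ≠ f(x',y) then either p(x,y) = p(x',y) = 0 or both p(x,y) > 0 and p(x',y) > 0. Then in the 0-characteristic hypergraph G = G_{f,0;X|Y}, every vertex belongs to at most one maximal hyperedge: if x ∈ w₁ and x ∈ w₂ with w₁, w₂ maximal hyperedges of G, then w₁ = w₂. -/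
open scoped BigOperators

noncomputable section

/-- `S` is a hyperedge of the 0-characteristic hypergraph `G = G_{f,0;X|Y}`:
for all `x₁, x₂ ∈ S` and all `y`, either `f(x₁,y) = f(x₂,y)` or one of the two
pairs has zero probability. -/
def IsHyperedge0 {X Y E : Type*} (p : X → Y → ℝ) (f : X → Y → E) (S : Finset X) : Prop :=
  S.Nonempty ∧ ∀ x₁ ∈ S, ∀ x₂ ∈ S, ∀ y : Y, f x₁ y = f x₂ y ∨ p x₁ y = 0 ∨ p x₂ y = 0

/-- A maximal hyperedge: a hyperedge that is not a proper subset of any other hyperedge. -/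
def IsMaximalHyperedge0 {X Y E : Type*} (p : X → Y → ℝ) (f : X → Y → E)
    (S : Finset X) : Prop :=
  IsHyperedge0 p f S ∧ ∀ T : Finset X, IsHyperedge0 p f T → ¬ S ⊂ T

/-- Under Condition 1, compatibility of two vertices is transitive. -/
theorem compatible_trans {X Y E : Type*} {p : X → Y → ℝ} {f : X → Y → E}
    (cond1 : ∀ (y : Y) (x x' : X), f x y ≠ f x' y →
      (p x y = 0 ∧ p x' y = 0) ∨ (0 < p x y ∧ 0 < p x' y))
    {a b c : X} {y : Y}
    (hab : f a y = f b y ∨ p a y = 0 ∨ p b y = 0)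
    (hbc : f b y = f c y ∨ p b y = 0 ∨ p c y = 0) :
    f a y = f c y ∨ p a y = 0 ∨ p c y = 0 := by
  have h₁ := cond1 y a b
  have h₂ := cond1 y b c
  grind

/-- Under Condition 1, the union of two hyperedges with a common vertex is a hyperedge. -/
theorem IsHyperedge0.union {X Y E : Type*} [DecidableEq X] {p : X → Y → ℝ} {f : X → Y → E}
    (cond1 : ∀ (y : Y) (x x' : X), f x y ≠ f x' y →
      (p x y = 0 ∧ p x' y = 0) ∨ (0 < p x y ∧ 0 < p x' y))
    {S T : Finset X} (hS : IsHyperedge0 p f S) (hT : IsHyperedge0 p f T)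
    {x : X} (hxS : x ∈ S) (hxT : x ∈ T) : IsHyperedge0 p f (S ∪ T) := by
  refine ⟨⟨x, Finset.mem_union_left T hxS⟩, fun a ha b hb y => ?_⟩
  have key : ∀ c ∈ S ∪ T, (f c y = f x y ∨ p c y = 0 ∨ p x y = 0) ∧
      (f x y = f c y ∨ p x y = 0 ∨ p c y = 0) := by
    intro c hc
    rcases Finset.mem_union.mp hc with hc | hc
    · exact ⟨hS.2 c hc x hxS y, hS.2 x hxS c hc y⟩
    · exact ⟨hT.2 c hc x hxT y, hT.2 x hxT c hc y⟩
  exact compatible_trans cond1 (key a ha).1 (key b hb).2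

/-- **Theorem 3**: under Condition 1 (for every `y`, if `f(x,y) ≠ f(x',y)` then either
both `p(x,y), p(x',y)` vanish, or both are positive), every vertex belongs to at most
one maximal hyperedge of the 0-characteristic hypergraph. -/
theorem stmt_3 {X Y : Type*} [Fintype X] [Fintype Y] [DecidableEq X] {d : ℕ}
    (p : X → Y → ℝ) (f : X → Y → EuclideanSpace ℝ (Fin d))
    (hp : IsJointPMF p)
    (cond1 : ∀ (y : Y) (x x' : X), f x y ≠ f x' y →
      (p x y = 0 ∧ p x' y = 0) ∨ (0 < p x y ∧ 0 < p x' y)) :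
    ∀ (x : X) (w₁ w₂ : Finset X),
      IsMaximalHyperedge0 p f w₁ → IsMaximalHyperedge0 p f w₂ →
      x ∈ w₁ → x ∈ w₂ → w₁ = w₂ := by
  intro x w₁ w₂ h₁ h₂ hx₁ hx₂
  have hU := h₁.1.union cond1 h₂.1 hx₁ hx₂
  have e₁ : w₁ = w₁ ∪ w₂ :=
    Finset.subset_union_left.eq_of_not_ssubset (h₁.2 _ hU)
  have e₂ : w₂ = w₁ ∪ w₂ :=
    Finset.subset_union_right.eq_of_not_ssubset (h₂.2 _ hU)
  exact e₁.trans e₂.symm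
end
end

section
/- Let 𝒳, 𝒴 be finite sets and let the joint pmf factor as p(x,y) = p_X(x)·p_Y(y) with p_X(x) > 0 for all x ∈ 𝒳 and p_Y(y) > 0 for all y ∈ 𝒴 (X and Y independent with full support). Let f : 𝒳×𝒴 → ℝ^d. Then every vertex x ∈ 𝒳 belongs to exactly one maximal hyperedge of the 0-characteristic hypergraph G = G_{f,0;X|Y}. -/
open scoped BigOperators

noncomputable section

theorem isHyperedge0_iff_of_ne_zero {X Y E : Type*} {p : X → Y → ℝ} (f : X → Y → E)
    (hp : ∀ x y, p x y ≠ 0) (S : Finset X) :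
    IsHyperedge0 p f S ↔ S.Nonempty ∧ ∀ x₁ ∈ S, ∀ x₂ ∈ S, f x₁ = f x₂ := by
  simp only [IsHyperedge0, hp, or_false, funext_iff]

open scoped Classical in
/-- When `p` has full support, the maximal hyperedges are the fibres of `x ↦ f x`. -/
theorem isMaximalHyperedge0_and_mem_iff {X Y E : Type*} [Fintype X] {p : X → Y → ℝ}
    (f : X → Y → E) (hp : ∀ x y, p x y ≠ 0) (x : X) (S : Finset X) :
    IsMaximalHyperedge0 p f S ∧ x ∈ S ↔ S = Finset.univ.filter fun z => f z = f x := by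
  have hfib : IsHyperedge0 p f (Finset.univ.filter fun z => f z = f x) := by
    refine (isHyperedge0_iff_of_ne_zero f hp _).2 ⟨⟨x, by simp⟩, fun a ha b hb => ?_⟩
    exact (Finset.mem_filter.1 ha).2.trans (Finset.mem_filter.1 hb).2.symm
  have hsub : ∀ T, IsHyperedge0 p f T → x ∈ T → T ⊆ Finset.univ.filter fun z => f z = f x :=
    fun T hT hx z hz => Finset.mem_filter.2
      ⟨Finset.mem_univ z, ((isHyperedge0_iff_of_ne_zero f hp T).1 hT).2 z hz x hx⟩
  constructor
  · rintro ⟨⟨hS, hmax⟩, hx⟩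
    exact (hsub S hS hx).eq_of_not_ssubset (hmax _ hfib)
  · rintro rfl
    have hx : x ∈ Finset.univ.filter fun z => f z = f x := by simp
    exact ⟨⟨hfib, fun T hT hlt => hlt.2 (hsub T hT (hlt.1 hx))⟩, hx⟩

/-- If `X` and `Y` are independent with full support, i.e. `p(x,y) = p_X(x)·p_Y(y)`
with `p_X, p_Y` strictly positive pmfs, then every vertex belongs to exactly one
maximal hyperedge of the 0-characteristic hypergraph. -/
theorem stmt_4 {X Y : Type*} [Fintype X] [Fintype Y] [DecidableEq X] {d : ℕ}
    (pX : X → ℝ) (pY : Y → ℝ) (p : X → Y → ℝ)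
    (f : X → Y → EuclideanSpace ℝ (Fin d))
    (hfac : ∀ x y, p x y = pX x * pY y)
    (hpX : ∀ x, 0 < pX x) (hpY : ∀ y, 0 < pY y)
    (hpX1 : ∑ x, pX x = 1) (hpY1 : ∑ y, pY y = 1) :
    ∀ x : X, ∃! w : Finset X, IsMaximalHyperedge0 p f w ∧ x ∈ w := by
  intro x
  have hp : ∀ x y, p x y ≠ 0 := fun x y => hfac x y ▸ (mul_pos (hpX x) (hpY y)).ne'
  simp only [isMaximalHyperedge0_and_mem_iff f hp x]
  exact existsUnique_eq
end
end

section
/- Let 𝒳 ⊂ ℝ^m be a finite set, f : ℝ^m → ℝ^d an L-Lipschitz function (L > 0), p a pmf on 𝒳, and ε ≥ 0. Then H_{G_{f,ε}}(X) ≤ H_{G_{id,ε/L}}(X), where G_{f,ε} is the ε-characteristic hypergraph of X with respect to f and G_{id,ε/L} is the (ε/L)-characteristic hypergraph of X with respect to the identity function. -/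
open scoped BigOperators

noncomputable section

/-- `S` is a hyperedge of the ε-characteristic hypergraph (no side information). -/
def IsHyperedgeNS {X E : Type*} [NormedAddCommGroup E]
    (p : X → ℝ) (h : X → E) (ε : ℝ) (S : Finset X) : Prop :=
  S.Nonempty ∧ ∃ z : E, ∀ x ∈ S, 0 < p x → ‖h x - z‖ ≤ ε

/-- Mutual information `I(W;X)` of a joint pmf `q` on `W × X` (in bits). -/
noncomputable def mutInf {W X : Type*} [Fintype W] [Fintype X] (q : W → X → ℝ) : ℝ :=
  ∑ w, ∑ x, q w x * Real.logb 2 (q w x / ((∑ x', q w x') * (∑ w', q w' x)))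

/-- The functional ε-entropy `H_{G_{h,ε}}(X)` (no side information). -/
noncomputable def funcEntropyNS {X E : Type*} [Fintype X] [DecidableEq X]
    [NormedAddCommGroup E] (p : X → ℝ) (h : X → E) (ε : ℝ) : ℝ :=
  sInf {i : ℝ | ∃ r : X → Finset X → ℝ, IsCondPMF r ∧
    (∀ x w, 0 < r x w → x ∈ w ∧ IsHyperedgeNS p h ε w) ∧
    i = mutInf (fun w x => p x * r x w)}

/-- The mutual information of a joint pmf is nonnegative. -/
theorem mutInf_nonneg {W X : Type*} [Fintype W] [Fintype X] {q : W → X → ℝ}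
    (hq : ∀ w x, 0 ≤ q w x) (hsum : ∑ w, ∑ x, q w x = 1) : 0 ≤ mutInf q := by
  set a : W → ℝ := fun w => ∑ x, q w x with ha
  set b : X → ℝ := fun x => ∑ w, q w x with hb
  have hqa : ∀ w x, q w x ≤ a w := fun w x =>
    Finset.single_le_sum (f := fun x => q w x) (fun x _ => hq w x) (Finset.mem_univ x)
  have hqb : ∀ w x, q w x ≤ b x := fun w x =>
    Finset.single_le_sum (f := fun w => q w x) (fun w _ => hq w x) (Finset.mem_univ w)
  have hlog : 0 < Real.log 2 := Real.log_pos one_lt_two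
  have term : ∀ w x, (q w x - a w * b x) / Real.log 2 ≤
      q w x * Real.logb 2 (q w x / (a w * b x)) := by
    intro w x
    rw [Real.logb, ← mul_div_assoc]
    refine div_le_div_of_nonneg_right ?_ hlog.le
    rcases (hq w x).eq_or_lt with h0 | hpos
    · have := mul_nonneg ((hq w x).trans (hqa w x)) ((hq w x).trans (hqb w x))
      rw [← h0]
      linarith
    · have hab : 0 < a w * b x :=
        mul_pos (hpos.trans_le (hqa w x)) (hpos.trans_le (hqb w x))
      have key := mul_le_mul_of_nonneg_left
        (Real.one_sub_inv_le_log_of_pos (div_pos hpos hab)) hpos.le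
      have heq : q w x * (1 - (q w x / (a w * b x))⁻¹) = q w x - a w * b x := by
        field_simp
      rwa [heq] at key
  have hbsum : ∑ x, b x = 1 := by rw [← hsum, Finset.sum_comm]
  have hzero : ∑ w, ∑ x, (q w x - a w * b x) / Real.log 2 = 0 := by
    simp only [← Finset.sum_div, Finset.sum_sub_distrib, ← Finset.mul_sum, hbsum, mul_one]
    simp [ha]
  rw [← hzero]
  exact Finset.sum_le_sum fun w _ => Finset.sum_le_sum fun x _ => term w x

/-- Singletons are hyperedges of every characteristic hypergraph with `0 ≤ ε`. -/
theorem isHyperedgeNS_singleton {X E : Type*} [NormedAddCommGroup E]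
    (p : X → ℝ) (h : X → E) {ε : ℝ} (hε : 0 ≤ ε) (x : X) : IsHyperedgeNS p h ε {x} :=
  ⟨Finset.singleton_nonempty x, h x, fun y hy _ => by
    rw [Finset.mem_singleton.mp hy, sub_self, norm_zero]; exact hε⟩

/-- Functional entropy is antitone in the set of hyperedges. -/
theorem funcEntropyNS_le_of_isHyperedgeNS_imp {X E F : Type*} [Fintype X] [DecidableEq X]
    [NormedAddCommGroup E] [NormedAddCommGroup F] {p : X → ℝ}
    (hp : (∀ x, 0 ≤ p x) ∧ ∑ x, p x = 1) {g : X → E} {h : X → F} {δ ε : ℝ} (hδ : 0 ≤ δ)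
    (himp : ∀ S, IsHyperedgeNS p g δ S → IsHyperedgeNS p h ε S) :
    funcEntropyNS p h ε ≤ funcEntropyNS p g δ := by
  refine csInf_le_csInf ⟨0, ?_⟩ ?_ ?_
  · rintro _ ⟨r, hr, -, rfl⟩
    refine mutInf_nonneg (fun w x => mul_nonneg (hp.1 x) ((hr x).1 w)) ?_
    rw [Finset.sum_comm]
    simp only [← Finset.mul_sum, (hr _).2, mul_one, hp.2]
  · refine ⟨_, fun x w => if w = {x} then 1 else 0, fun x => ⟨fun w => ?_, by simp⟩, ?_, rfl⟩
    · dsimp only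
      split_ifs <;> norm_num
    · intro x w hw
      obtain rfl : w = {x} := by
        by_contra hne
        simp [hne] at hw
      exact ⟨Finset.mem_singleton_self x, isHyperedgeNS_singleton p g hδ x⟩
  · rintro _ ⟨r, hr, hedge, rfl⟩
    exact ⟨r, hr, fun x w hw => ⟨(hedge x w hw).1, himp w (hedge x w hw).2⟩, rfl⟩

/-- **Corollary (L-Lipschitz functions)**: for an `L`-Lipschitz `f` on a finite set
`𝒳 ⊂ ℝ^m` (represented by an injection `ι`), `H_{G_{f,ε}}(X) ≤ H_{G_{id,ε/L}}(X)`. -/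
theorem stmt_8 {X : Type*} [Fintype X] [DecidableEq X] {m d : ℕ}
    (ι : X → EuclideanSpace ℝ (Fin m)) (hι : Function.Injective ι)
    (f : EuclideanSpace ℝ (Fin m) → EuclideanSpace ℝ (Fin d)) (L : ℝ) (hL : 0 < L)
    (hf : ∀ x₁ x₂, ‖f x₁ - f x₂‖ ≤ L * ‖x₁ - x₂‖)
    (p : X → ℝ) (hp : (∀ x, 0 ≤ p x) ∧ ∑ x, p x = 1)
    (ε : ℝ) (hε : 0 ≤ ε) :
    funcEntropyNS p (fun x => f (ι x)) ε ≤ funcEntropyNS p ι (ε / L) := by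
  refine funcEntropyNS_le_of_isHyperedgeNS_imp hp (div_nonneg hε hL.le) ?_
  rintro S ⟨hS, z, hz⟩
  refine ⟨hS, f z, fun x hx hpx => (hf _ _).trans ?_⟩
  rw [mul_comm]
  exact (le_div_iff₀ hL).mp (hz x hx hpx)
end
end

section
/- Let 𝒳, 𝒴 be finite sets, p(x,y) = p_X(x)·p_Y(y) with p_X, p_Y strictly positive (X and Y independent with full support), and f : 𝒳×𝒴 → ℝ^d. Let q : 𝒳 → Γ_m(G) assign to each x the unique maximal hyperedge of the 0-characteristic hypergraph G = G_{f,0;X|Y} containing x. Then H_{G}(X|Y) = H(q(X)), i.e., the minimum of I(W;X|Y) over admissible W equals the Shannon entropy −Σ_w P(q(X) = w)·log₂ P(q(X) = w). -/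
open scoped BigOperators

noncomputable section

/-- Under independence with full support, `condMI` no longer involves `Y`. -/
theorem condMI_of_indep {W X Y : Type*} [Fintype W] [Fintype X] [Fintype Y]
    {pX : X → ℝ} {pY : Y → ℝ} {r : X → W → ℝ}
    (hpX : ∀ x, 0 < pX x) (hpY : ∀ y, 0 < pY y)
    (hpX1 : ∑ x, pX x = 1) (hpY1 : ∑ y, pY y = 1) (hr : IsCondPMF r) :
    condMI (fun w x y => pX x * pY y * r x w) =
      ∑ w, ∑ x, pX x * r x w * Real.logb 2 (r x w / ∑ x', pX x' * r x' w) := by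
  unfold condMI
  refine Finset.sum_congr rfl fun w _ => Finset.sum_congr rfl fun x _ => ?_
  have hY (y : Y) : ∑ w', ∑ x', pX x' * pY y * r x' w' = pY y := by
    rw [Finset.sum_comm]
    simp_rw [← Finset.mul_sum, (hr _).2, mul_one, ← Finset.sum_mul, hpX1, one_mul]
  have hXY (y : Y) : ∑ w', pX x * pY y * r x w' = pX x * pY y := by
    rw [← Finset.mul_sum, (hr x).2, mul_one]
  have hWY (y : Y) : ∑ x', pX x' * pY y * r x' w = pY y * ∑ x', pX x' * r x' w := by
    rw [Finset.mul_sum]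
    exact Finset.sum_congr rfl fun _ _ => by ring
  calc ∑ y, pX x * pY y * r x w * Real.logb 2 ((pX x * pY y * r x w *
          (∑ w', ∑ x', pX x' * pY y * r x' w')) /
          ((∑ x', pX x' * pY y * r x' w) * (∑ w', pX x * pY y * r x w')))
      = ∑ y, pY y * (pX x * r x w * Real.logb 2 (r x w / ∑ x', pX x' * r x' w)) := by
        refine Finset.sum_congr rfl fun y _ => ?_
        have h1 := (hpX x).ne'
        have h2 := (hpY y).ne'
        have harg : pX x * pY y * r x w * pY y /
            ((pY y * ∑ x', pX x' * r x' w) * (pX x * pY y)) =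
            r x w / ∑ x', pX x' * r x' w := by
          rw [← mul_div_mul_left (r x w) (∑ x', pX x' * r x' w)
            (mul_ne_zero (mul_ne_zero h1 h2) h2)]
          congr 1 <;> ring
        rw [hY, hXY, hWY, harg]
        ring
    _ = _ := by rw [← Finset.sum_mul, hpY1, one_mul]

/-- Every hyperedge is contained in a maximal one. -/
theorem IsHyperedge0.exists_maximal {X Y E : Type*} [Fintype X] {p : X → Y → ℝ}
    {f : X → Y → E} {S : Finset X} (hS : IsHyperedge0 p f S) :
    ∃ T, S ⊆ T ∧ IsMaximalHyperedge0 p f T := by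
  obtain ⟨T, hST, hT⟩ := (Set.toFinite {T | IsHyperedge0 p f T}).exists_le_maximal hS
  exact ⟨T, hST, hT.prop, fun U hU => hT.not_gt hU⟩

/-- The entropy of `q(X)` as an expectation over `X`. -/
theorem sum_fiber_mul_logb {X U : Type*} [Fintype X] [Fintype U] [DecidableEq U]
    (pX : X → ℝ) (q : X → U) :
    ∑ w, (∑ x with q x = w, pX x) * Real.logb 2 (∑ x with q x = w, pX x) =
      ∑ x, pX x * Real.logb 2 (∑ x' with q x' = q x, pX x') := by
  rw [← Finset.sum_fiberwise Finset.univ q]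
  refine Finset.sum_congr rfl fun w _ => ?_
  rw [Finset.sum_mul]
  refine Finset.sum_congr rfl fun x hx => ?_
  rw [(Finset.mem_filter.1 hx).2]

/-- If all `x` compatible with `w` lie in one fibre of `q`, the contribution of `w` to `I(W;X)`
dominates its contribution to `H(q(X))`. -/
theorem sum_mul_neg_logb_fiber_le {X U : Type*} [Fintype X] [DecidableEq U]
    {pX : X → ℝ} (hpX : ∀ x, 0 < pX x) (q : X → U) {ρ : X → ℝ} (hρ : ∀ x, 0 ≤ ρ x)
    (hq : ∀ x x', 0 < ρ x → 0 < ρ x' → q x = q x') :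
    ∑ x, pX x * ρ x * -Real.logb 2 (∑ x' with q x' = q x, pX x') ≤
      ∑ x, pX x * ρ x * Real.logb 2 (ρ x / ∑ x', pX x' * ρ x') := by
  set P : X → ℝ := fun x => ∑ x' with q x' = q x, pX x' with hP
  set m : ℝ := ∑ x', pX x' * ρ x' with hm
  have hP0 (x : X) : 0 < P x :=
    Finset.sum_pos (fun x' _ => hpX x') ⟨x, by simp⟩
  by_cases hex : ∃ x₀, 0 < ρ x₀
  swap
  · have h0 (x : X) : ρ x = 0 := le_antisymm (not_lt.1 fun h => hex ⟨x, h⟩) (hρ x)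
    simp [h0]
  obtain ⟨x₀, hx₀⟩ := hex
  have hm0 : 0 < m := Finset.sum_pos' (fun x _ => mul_nonneg (hpX x).le (hρ x))
    ⟨x₀, Finset.mem_univ _, mul_pos (hpX x₀) hx₀⟩
  have hlog2 : 0 < Real.log 2 := Real.log_pos one_lt_two
  have hterm (x : X) : pX x * ρ x - m * (if q x = q x₀ then pX x / P x₀ else 0) ≤
      (pX x * ρ x * Real.logb 2 (ρ x / m) - pX x * ρ x * -Real.logb 2 (P x)) * Real.log 2 := by
    rcases (hρ x).eq_or_lt with h | h
    · rw [← h]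
      have : 0 ≤ m * (if q x = q x₀ then pX x / P x₀ else 0) := by
        have := (hpX x).le
        have := (hP0 x₀).le
        split_ifs <;> positivity
      simpa using this
    · have hqx := hq x x₀ h hx₀
      have hPx : P x = P x₀ := by simp only [hP, hqx]
      rw [if_pos hqx, hPx]
      have ht : 0 < ρ x / m * P x₀ := mul_pos (div_pos h hm0) (hP0 x₀)
      have hle := mul_le_mul_of_nonneg_left (Real.one_sub_inv_le_log_of_pos ht)
        (mul_pos (hpX x) h).le
      rw [Real.log_mul (div_pos h hm0).ne' (hP0 x₀).ne'] at hle
      have hl : pX x * ρ x * (1 - (ρ x / m * P x₀)⁻¹) = pX x * ρ x - m * (pX x / P x₀) := by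
        have := (hP0 x₀).ne'
        field_simp
      have hr : (pX x * ρ x * Real.logb 2 (ρ x / m) - pX x * ρ x * -Real.logb 2 (P x₀)) *
          Real.log 2 = pX x * ρ x * (Real.log (ρ x / m) + Real.log (P x₀)) := by
        simp only [Real.logb]
        field_simp
        ring
      rw [hr, ← hl]
      exact hle
  have hsum := Finset.sum_le_sum fun x (_ : x ∈ Finset.univ) => hterm x
  rw [Finset.sum_sub_distrib, ← Finset.mul_sum, ← Finset.sum_filter, ← Finset.sum_div,
    div_self (hP0 x₀).ne', mul_one, ← hm, sub_self, ← Finset.sum_mul,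
    Finset.sum_sub_distrib] at hsum
  exact sub_nonneg.1 (nonneg_of_mul_nonneg_left hsum hlog2)

/-- When `X ⟂ Y` with full support, `H_G(X|Y) = H(q(X))` where `q(x)` is the unique
maximal hyperedge of the 0-characteristic hypergraph containing `x`. -/
theorem stmt_11 {X Y : Type*} [Fintype X] [Fintype Y] [DecidableEq X] {d : ℕ}
    (pX : X → ℝ) (pY : Y → ℝ) (p : X → Y → ℝ)
    (f : X → Y → EuclideanSpace ℝ (Fin d))
    (hfac : ∀ x y, p x y = pX x * pY y)
    (hpX : ∀ x, 0 < pX x) (hpY : ∀ y, 0 < pY y)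
    (hpX1 : ∑ x, pX x = 1) (hpY1 : ∑ y, pY y = 1)
    (q : X → Finset X)
    (hq : ∀ x, IsMaximalHyperedge0 p f (q x) ∧ x ∈ q x)
    (hq_unique : ∀ (x : X) (w : Finset X),
      IsMaximalHyperedge0 p f w → x ∈ w → w = q x) :
    sInf {i : ℝ | ∃ r : X → Finset X → ℝ, IsCondPMF r ∧
        (∀ x w, 0 < r x w → x ∈ w ∧ IsHyperedge0 p f w) ∧
        i = condMI (fun w x y => p x y * r x w)} =
    -∑ w : Finset X,
      (∑ x ∈ Finset.univ.filter (fun x => q x = w), pX x) *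
        Real.logb 2 (∑ x ∈ Finset.univ.filter (fun x => q x = w), pX x) := by
  obtain rfl : p = fun x y => pX x * pY y := funext₂ hfac
  rw [sum_fiber_mul_logb]
  refine IsLeast.csInf_eq ⟨?_, ?_⟩
  · have hr : IsCondPMF fun x w => if q x = w then (1 : ℝ) else 0 :=
      fun x => ⟨fun u => by positivity, by simp⟩
    refine ⟨_, hr, fun x w h => ?_, ?_⟩
    · have hw : q x = w := by
        by_contra hne
        simp [hne] at h
      exact hw ▸ ⟨(hq x).2, (hq x).1.1⟩
    · rw [condMI_of_indep hpX hpY hpX1 hpY1 hr, Finset.sum_comm, ← Finset.sum_neg_distrib]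
      refine Finset.sum_congr rfl fun x _ => ?_
      rw [Finset.sum_eq_single (q x) (fun w _ hw => by simp [hw.symm]) (by simp)]
      simp [Finset.sum_filter, Real.logb_inv]
  · rintro _ ⟨r, hr, hadm, rfl⟩
    rw [condMI_of_indep hpX hpY hpX1 hpY1 hr]
    have hfib (w : Finset X) (x x' : X) (hx : 0 < r x w) (hx' : 0 < r x' w) : q x = q x' := by
      obtain ⟨hxw, hw⟩ := hadm x w hx
      obtain ⟨T, hwT, hT⟩ := hw.exists_maximal
      exact (hq_unique x T hT (hwT hxw)).symm.trans
        (hq_unique x' T hT (hwT (hadm x' w hx').1))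
    refine le_trans (le_of_eq ?_) (Finset.sum_le_sum fun w _ =>
      sum_mul_neg_logb_fiber_le hpX q (fun x => (hr x).1 w) (hfib w))
    rw [Finset.sum_comm, ← Finset.sum_neg_distrib]
    refine Finset.sum_congr rfl fun x _ => ?_
    rw [← Finset.sum_mul, ← Finset.mul_sum, (hr x).2]
    ring
end
end

section
/- Let 𝒳 = {1,2,3}, X uniform on 𝒳, f : 𝒳 → ℝ² given by f(1) = (1,1), f(2) = (2,2.5), f(3) = (3,1), and √13/4 ≤ ε < 1. Then the hyperedges of the ε-characteristic hypergraph G_ε are exactly the singletons together with {1,2} and {2,3}, and H_{G_ε}(X) = 2/3. -/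
open scoped BigOperators

noncomputable section

/-- The point `(a, b) ∈ ℝ²` with the Euclidean norm. -/
noncomputable def vec2 (a b : ℝ) : EuclideanSpace ℝ (Fin 2) :=
  (WithLp.equiv 2 (Fin 2 → ℝ)).symm ![a, b]

/-- The function of Example 3: `f(1) = (1,1)`, `f(2) = (2,2.5)`, `f(3) = (3,1)`,
with `𝒳 = {1,2,3}` encoded as `Fin 3` (vertex `i` standing for `i+1`). -/
noncomputable def fEx3 : Fin 3 → EuclideanSpace ℝ (Fin 2) :=
  ![vec2 1 1, vec2 2 2.5, vec2 3 1]

/-- The uniform pmf on `𝒳 = {1,2,3}`. -/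
noncomputable def pEx3 (_ : Fin 3) : ℝ := 1 / 3

lemma norm_vec2_sub_vec2 (a b c d : ℝ) :
    ‖vec2 a b - vec2 c d‖ = √((a - c) ^ 2 + (b - d) ^ 2) := by
  simp [EuclideanSpace.norm_eq, vec2, Fin.sum_univ_two]

/-- A dual lower bound on mutual information: any weight `l` whose `p`-average over each
used hyperedge is at most `1` gives `∑ x, p x * logb 2 (l x) ≤ I(W;X)`. -/
lemma sum_mul_logb_le_mutInf {X : Type*} [Fintype X] [DecidableEq X]
    {p l : X → ℝ} {r : X → Finset X → ℝ} (hp : ∀ x, 0 < p x) (hp1 : ∑ x, p x = 1)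
    (hl : ∀ x, 0 < l x) (hr : IsCondPMF r)
    (hrw : ∀ x w, 0 < r x w → x ∈ w ∧ ∑ y ∈ w, p y * l y ≤ 1) :
    ∑ x, p x * Real.logb 2 (l x) ≤ mutInf (fun w x => p x * r x w) := by
  have hq : ∀ x w, 0 ≤ p x * r x w := fun x w => mul_nonneg (hp x).le ((hr x).1 w)
  have hmarg : ∀ x, ∑ w, p x * r x w = p x := fun x => by
    rw [← Finset.mul_sum, (hr x).2, mul_one]
  have hlog2 : 0 < Real.log 2 := Real.log_pos one_lt_two
  set P : Finset X → ℝ := fun w => ∑ x, p x * r x w with hP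
  have hP0 : ∀ w, 0 ≤ P w := fun w => Finset.sum_nonneg fun x _ => hq x w
  have htotal : ∑ w, P w = 1 := by
    rw [hP, Finset.sum_comm]
    simp_rw [hmarg, hp1]
  have hpoint : ∀ w x, p x * r x w * Real.logb 2 (l x) +
      (p x * r x w - if x ∈ w then P w * (p x * l x) else 0) / Real.log 2 ≤
      p x * r x w * Real.logb 2 (p x * r x w / (P w * p x)) := by
    intro w x
    rcases (hq x w).eq_or_lt with h0 | hpos
    · rw [← h0]
      have : 0 ≤ if x ∈ w then P w * (p x * l x) else 0 := by
        split_ifs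
        · exact mul_nonneg (hP0 w) (mul_pos (hp x) (hl x)).le
        · exact le_rfl
      simp only [zero_mul, zero_sub, zero_add]
      exact div_nonpos_of_nonpos_of_nonneg (neg_nonpos.2 this) hlog2.le
    · have hrpos : 0 < r x w := pos_of_mul_pos_right hpos (hp x).le
      have hPw : 0 < P w := hpos.trans_le
        (Finset.single_le_sum (f := fun y => p y * r y w) (fun y _ => hq y w)
          (Finset.mem_univ x))
      have hpx := hp x
      have hlx := hl x
      rw [if_pos (hrw x w hrpos).1]
      have hlog := Real.one_sub_inv_le_log_of_pos
        (show 0 < p x * r x w / (P w * p x) / l x by positivity)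
      rw [Real.log_div (by positivity) hlx.ne'] at hlog
      have hmul := mul_le_mul_of_nonneg_left hlog hpos.le
      have hid : p x * r x w * (1 - (p x * r x w / (P w * p x) / l x)⁻¹) =
          p x * r x w - P w * (p x * l x) := by
        field_simp
      rw [hid] at hmul
      simp only [Real.logb]
      rw [← mul_div_assoc, ← mul_div_assoc, ← add_div]
      gcongr
      linarith
  have hslack : ∀ w, ∑ x, (if x ∈ w then P w * (p x * l x) else 0) ≤ P w := by
    intro w
    rw [Finset.sum_ite_mem, Finset.univ_inter, ← Finset.mul_sum]
    rcases (hP0 w).eq_or_lt with h0 | hpos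
    · simp [← h0]
    · obtain ⟨x, -, hx⟩ := Finset.exists_lt_of_sum_lt (s := Finset.univ)
        (f := fun _ : X => (0 : ℝ)) (g := fun x => p x * r x w) (by simpa using hpos)
      exact mul_le_of_le_one_right hpos.le
        (hrw x w (pos_of_mul_pos_right hx (hp x).le)).2
  have hsum := Finset.sum_le_sum fun w (_ : w ∈ (Finset.univ : Finset (Finset X))) =>
    Finset.sum_le_sum fun x (_ : x ∈ (Finset.univ : Finset X)) => hpoint w x
  have hmain : ∑ w : Finset X, ∑ x, p x * r x w * Real.logb 2 (l x) =
      ∑ x, p x * Real.logb 2 (l x) := by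
    rw [Finset.sum_comm]
    simp_rw [← Finset.sum_mul, hmarg]
  have hrest : 0 ≤ ∑ w : Finset X, ∑ x,
      (p x * r x w - if x ∈ w then P w * (p x * l x) else 0) / Real.log 2 := by
    refine Finset.sum_nonneg fun w _ => ?_
    rw [← Finset.sum_div, Finset.sum_sub_distrib]
    exact div_nonneg (sub_nonneg.2 (hslack w)) hlog2.le
  simp_rw [Finset.sum_add_distrib] at hsum
  rw [hmain] at hsum
  simp only [mutInf, hmarg]
  linarith

lemma isHyperedgeNS_fEx3_iff {ε : ℝ} (hε0 : Real.sqrt 13 / 4 ≤ ε) (hε : ε < 1)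
    (S : Finset (Fin 3)) : IsHyperedgeNS pEx3 fEx3 ε S ↔
      ((∃ x, S = {x}) ∨ S = {0, 1} ∨ S = {1, 2}) := by
  have hp : ∀ x, 0 < pEx3 x := fun x => by norm_num [pEx3]
  have hnonneg : 0 ≤ ε := le_trans (by positivity) hε0
  have hsq : √(13 / 16) ≤ ε := by
    refine le_trans (le_of_eq ?_) hε0
    rw [Real.sqrt_div (by norm_num), show (16 : ℝ) = 4 ^ 2 by norm_num,
      Real.sqrt_sq (by norm_num)]
  constructor
  · rintro ⟨hne, z, hz⟩
    have h02 : ¬(0 ∈ S ∧ 2 ∈ S) := by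
      rintro ⟨h0, h2⟩
      have hdist := norm_sub_le_norm_sub_add_norm_sub (fEx3 0) z (fEx3 2)
      rw [norm_sub_rev z] at hdist
      have hval : ‖fEx3 0 - fEx3 2‖ = 2 := by
        rw [show fEx3 0 = vec2 1 1 from rfl, show fEx3 2 = vec2 3 1 from rfl,
          norm_vec2_sub_vec2, Real.sqrt_eq_iff_mul_self_eq] <;> norm_num
      linarith [hz 0 h0 (hp 0), hz 2 h2 (hp 2)]
    clear hz
    revert S
    decide
  · rintro (⟨x, rfl⟩ | rfl | rfl)
    · exact ⟨by simp, fEx3 x, by simpa using fun _ => hnonneg⟩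
    · refine ⟨by simp, vec2 1.5 1.75, fun x hx _ => ?_⟩
      rw [Finset.mem_insert, Finset.mem_singleton] at hx
      refine le_trans (le_of_eq ?_) hsq
      rcases hx with rfl | rfl
      · rw [show fEx3 0 = vec2 1 1 from rfl, norm_vec2_sub_vec2]
        norm_num
      · rw [show fEx3 1 = vec2 2 2.5 from rfl, norm_vec2_sub_vec2]
        norm_num
    · refine ⟨by simp, vec2 2.5 1.75, fun x hx _ => ?_⟩
      rw [Finset.mem_insert, Finset.mem_singleton] at hx
      refine le_trans (le_of_eq ?_) hsq
      rcases hx with rfl | rfl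
      · rw [show fEx3 1 = vec2 2 2.5 from rfl, norm_vec2_sub_vec2]
        norm_num
      · rw [show fEx3 2 = vec2 3 1 from rfl, norm_vec2_sub_vec2]
        norm_num

/-- The optimal channel: `1 ↦ {1,2}`, `3 ↦ {2,3}`, and `2` goes to either with equal
probability. -/
def optimalChannel (x : Fin 3) (w : Finset (Fin 3)) : ℝ :=
  if w = {0, 1} then ![1, 1 / 2, 0] x else if w = {1, 2} then ![0, 1 / 2, 1] x else 0

lemma sum_finset_fin_three_eq_of_support (g : Finset (Fin 3) → ℝ)
    (hg : ∀ w, w ≠ {0, 1} → w ≠ {1, 2} → g w = 0) : ∑ w, g w = g {0, 1} + g {1, 2} := by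
  rw [← Finset.sum_subset (Finset.subset_univ {{0, 1}, {1, 2}}), Finset.sum_pair (by decide)]
  intro w _ hw
  rw [Finset.mem_insert, Finset.mem_singleton, not_or] at hw
  exact hg w hw.1 hw.2

lemma optimalChannel_left (x : Fin 3) : optimalChannel x {0, 1} = ![1, 1 / 2, 0] x :=
  if_pos rfl

lemma optimalChannel_right (x : Fin 3) : optimalChannel x {1, 2} = ![0, 1 / 2, 1] x := by
  rw [optimalChannel, if_neg (by decide), if_pos rfl]

lemma optimalChannel_of_ne (x : Fin 3) {w : Finset (Fin 3)} (h₁ : w ≠ {0, 1})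
    (h₂ : w ≠ {1, 2}) : optimalChannel x w = 0 := by
  rw [optimalChannel, if_neg h₁, if_neg h₂]

lemma sum_optimalChannel (x : Fin 3) : ∑ w, optimalChannel x w = 1 := by
  rw [sum_finset_fin_three_eq_of_support _ fun w => optimalChannel_of_ne x,
    optimalChannel_left, optimalChannel_right]
  fin_cases x <;> norm_num

lemma isCondPMF_optimalChannel : IsCondPMF optimalChannel := by
  refine fun x => ⟨fun w => ?_, sum_optimalChannel x⟩
  unfold optimalChannel
  split_ifs <;> fin_cases x <;> norm_num

lemma mutInf_optimalChannel :
    mutInf (fun w x => pEx3 x * optimalChannel x w) = 2 / 3 := by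
  simp only [mutInf, ← Finset.mul_sum, sum_optimalChannel]
  rw [sum_finset_fin_three_eq_of_support]
  · simp only [Fin.sum_univ_three, optimalChannel_left, optimalChannel_right, pEx3,
      Matrix.cons_val]
    norm_num
  · intro w h₁ h₂
    simp [optimalChannel_of_ne _ h₁ h₂]

/-- **Example 3, regime `√13/4 ≤ ε < 1`**: the hyperedges of `G_ε` are exactly the
singletons together with `{1,2}` and `{2,3}` (encoded as `{0,1}` and `{1,2}` in
`Fin 3`), and `H_{G_ε}(X) = 2/3`. -/
theorem stmt_15 (ε : ℝ) (hε0 : Real.sqrt 13 / 4 ≤ ε) (hε : ε < 1) :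
    (∀ S : Finset (Fin 3), IsHyperedgeNS pEx3 fEx3 ε S ↔
      ((∃ x, S = {x}) ∨ S = {0, 1} ∨ S = {1, 2})) ∧
    funcEntropyNS pEx3 fEx3 ε = 2 / 3 := by
  have hedge := isHyperedgeNS_fEx3_iff hε0 hε
  refine ⟨hedge, IsLeast.csInf_eq ⟨⟨optimalChannel, isCondPMF_optimalChannel, ?_,
    mutInf_optimalChannel.symm⟩, ?_⟩⟩
  · intro x w hw
    rw [hedge]
    by_cases h₁ : w = {0, 1}
    · subst h₁
      rw [optimalChannel_left] at hw
      refine ⟨?_, by simp⟩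
      fin_cases x <;> simp at hw ⊢
    · by_cases h₂ : w = {1, 2}
      · subst h₂
        rw [optimalChannel_right] at hw
        refine ⟨?_, by simp⟩
        fin_cases x <;> simp at hw ⊢
      · simp [optimalChannel_of_ne x h₁ h₂] at hw
  · rintro i ⟨r, hr, hrw, rfl⟩
    have hbound := sum_mul_logb_le_mutInf (p := pEx3) (l := ![2, 1, 2]) (r := r)
      (fun x => by norm_num [pEx3]) (by norm_num [pEx3])
      (fun x => by fin_cases x <;> norm_num) hr ?_
    · refine le_trans (le_of_eq ?_) hbound
      simp only [Fin.sum_univ_three, pEx3, Matrix.cons_val]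
      norm_num
    · intro x w hw
      obtain ⟨hx, hw'⟩ := hrw x w hw
      refine ⟨hx, ?_⟩
      rcases (hedge w).1 hw' with ⟨y, rfl⟩ | rfl | rfl
      · rw [Finset.sum_singleton]
        fin_cases y <;> norm_num [pEx3]
      · rw [Finset.sum_pair (by decide)]
        norm_num [pEx3]
      · rw [Finset.sum_pair (by decide)]
        simp only [pEx3, Matrix.cons_val]
        norm_num
end
end

section
/- Let 𝒳 = {1,2,3}, X uniform on 𝒳, f : 𝒳 → ℝ² given by f(1) = (1,1), f(2) = (2,2.5), f(3) = (3,1), and 1 ≤ ε < 13/12. Then the hyperedges of the ε-characteristic hypergraph G_ε are exactly the singletons and the three two-element subsets {1,2}, {2,3}, {1,3} (the full set {1,2,3} is not a hyperedge), and H_{G_ε}(X) = log₂ 3 − 1. -/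
open scoped BigOperators

noncomputable section

lemma norm_vec2_sub_le_iff (a b : ℝ) (z : EuclideanSpace ℝ (Fin 2)) {ε : ℝ} (hε : 0 ≤ ε) :
    ‖vec2 a b - z‖ ≤ ε ↔ (a - z 0) ^ 2 + (b - z 1) ^ 2 ≤ ε ^ 2 := by
  rw [EuclideanSpace.norm_eq, Real.sqrt_le_left hε]
  simp [Fin.sum_univ_two, vec2]

lemma isHyperedgeNS_ex3_iff {ε : ℝ} (hε0 : 1 ≤ ε) (hε : ε < 13 / 12) (S : Finset (Fin 3)) :
    IsHyperedgeNS pEx3 fEx3 ε S ↔ S.Nonempty ∧ S ≠ Finset.univ := by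
  have h0 : 0 ≤ ε := by linarith
  have h1 : 1 ≤ ε ^ 2 := by nlinarith
  refine and_congr_right fun _ => ⟨?_, fun hS => ?_⟩
  · rintro ⟨z, hz⟩ rfl
    have hp (x : Fin 3) : 0 < pEx3 x := by norm_num [pEx3]
    have e0 := (norm_vec2_sub_le_iff _ _ z h0).1 (hz 0 (Finset.mem_univ _) (hp 0))
    have e1 := (norm_vec2_sub_le_iff _ _ z h0).1 (hz 1 (Finset.mem_univ _) (hp 1))
    have e2 := (norm_vec2_sub_le_iff _ _ z h0).1 (hz 2 (Finset.mem_univ _) (hp 2))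
    nlinarith [sq_nonneg (z 0 - 2), sq_nonneg (z 1 - 17 / 12)]
  · obtain ⟨i, hi⟩ : ∃ i, i ∉ S := by
      by_contra! h
      exact hS (Finset.eq_univ_iff_forall.2 h)
    refine ⟨![vec2 2.5 1.75, vec2 2 1, vec2 1.5 1.75] i, fun x hx _ => ?_⟩
    have hxi : x ≠ i := fun h => hi (h ▸ hx)
    fin_cases i <;> fin_cases x <;> first
      | exact absurd rfl hxi
      | refine (norm_vec2_sub_le_iff _ _ _ h0).2 (le_trans ?_ h1)
        norm_num [vec2]

lemma mul_logb_div_ge {q s : ℝ} (hq : 0 ≤ q) (hs : q ≤ s) :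
    q * (Real.logb 2 3 - 1) + (q - s / 2) / Real.log 2 ≤ q * Real.logb 2 (q / (s * (1 / 3))) := by
  have hl : 0 < Real.log 2 := Real.log_pos one_lt_two
  rcases hq.eq_or_lt with rfl | hq
  · simpa using div_nonpos_of_nonpos_of_nonneg (by linarith : -(s / 2) ≤ 0) hl.le
  have hs0 : 0 < s := hq.trans_le hs
  have key : 1 - (2 * q / s)⁻¹ ≤ Real.log (2 * q / s) :=
    Real.one_sub_inv_le_log_of_pos (by positivity)
  have hsplit : Real.log (q / (s * (1 / 3))) = Real.log 3 - Real.log 2 + Real.log (2 * q / s) := by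
    rw [← Real.log_div (by norm_num) (by norm_num),
      ← Real.log_mul (by norm_num) (by positivity)]
    congr 1
    field_simp
  have hmul : q - s / 2 ≤ q * Real.log (2 * q / s) := by
    calc q - s / 2 = q * (1 - (2 * q / s)⁻¹) := by field_simp
      _ ≤ _ := by gcongr
  simp only [Real.logb]
  rw [hsplit]
  have : q * ((Real.log 3 - Real.log 2 + Real.log (2 * q / s)) / Real.log 2) =
      q * (Real.log 3 / Real.log 2 - 1) + q * Real.log (2 * q / s) / Real.log 2 := by
    field_simp
  rw [this]
  gcongr

lemma sum_mul_logb_div_ge {X : Type*} [Fintype X] {q : X → ℝ} (hq : ∀ x, 0 ≤ q x)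
    {w : Finset X} (hw : w.card ≤ 2) (hqw : ∀ x, x ∉ w → q x = 0) :
    (∑ x, q x) * (Real.logb 2 3 - 1) ≤
      ∑ x, q x * Real.logb 2 (q x / ((∑ x', q x') * (1 / 3))) := by
  set s := ∑ x, q x with hs
  have hsw : ∑ x ∈ w, q x = s :=
    Finset.sum_subset (Finset.subset_univ w) fun x _ hx => hqw x hx
  have hs0 : 0 ≤ s := Finset.sum_nonneg fun x _ => hq x
  have hcard : (w.card : ℝ) ≤ 2 := by exact_mod_cast hw
  calc s * (Real.logb 2 3 - 1)
      ≤ s * (Real.logb 2 3 - 1) + (s - w.card * (s / 2)) / Real.log 2 :=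
        le_add_of_nonneg_right
          (div_nonneg (by nlinarith) (Real.log_nonneg one_le_two))
    _ = ∑ x ∈ w, (q x * (Real.logb 2 3 - 1) + (q x - s / 2) / Real.log 2) := by
        rw [Finset.sum_add_distrib, ← Finset.sum_mul, ← Finset.sum_div, Finset.sum_sub_distrib,
          hsw, Finset.sum_const, nsmul_eq_mul]
    _ ≤ ∑ x ∈ w, q x * Real.logb 2 (q x / (s * (1 / 3))) :=
        Finset.sum_le_sum fun x _ => mul_logb_div_ge (hq x)
          (Finset.single_le_sum (fun y _ => hq y) (Finset.mem_univ x))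
    _ = ∑ x, q x * Real.logb 2 (q x / (s * (1 / 3))) :=
        Finset.sum_subset (Finset.subset_univ w) fun x _ hx => by rw [hqw x hx, zero_mul]

/-- The channel sending each `x : Fin 3` to a uniformly chosen pair containing it. -/
def pairChannel (x : Fin 3) (w : Finset (Fin 3)) : ℝ :=
  if x ∈ w ∧ w.card = 2 then 1 / 2 else 0

lemma sum_pairChannel (x : Fin 3) : ∑ w, pairChannel x w = 1 := by
  have h : (Finset.univ.filter fun w : Finset (Fin 3) => x ∈ w ∧ w.card = 2).card = 2 := by
    revert x
    decide
  simp only [pairChannel]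
  rw [← Finset.sum_filter, Finset.sum_const, h]
  norm_num

lemma mutInf_pairChannel :
    mutInf (fun w x => pEx3 x * pairChannel x w) = Real.logb 2 3 - 1 := by
  have hX (x : Fin 3) : ∑ w, pEx3 x * pairChannel x w = 1 / 3 := by
    rw [← Finset.mul_sum, sum_pairChannel, pEx3, mul_one]
  have hW {w : Finset (Fin 3)} (hw : w.card = 2) : ∑ x, pEx3 x * pairChannel x w = 1 / 3 := by
    simp only [pEx3, pairChannel, hw, and_true]
    rw [← Finset.mul_sum, Finset.sum_ite_mem, Finset.univ_inter, Finset.sum_const, hw]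
    norm_num
  have hterm (w : Finset (Fin 3)) (x : Fin 3) :
      pEx3 x * pairChannel x w * Real.logb 2 (pEx3 x * pairChannel x w /
        ((∑ x', pEx3 x' * pairChannel x' w) * ∑ w', pEx3 x * pairChannel x w')) =
      pairChannel x w * ((Real.logb 2 3 - 1) / 3) := by
    rw [hX]
    by_cases h : x ∈ w ∧ w.card = 2
    · rw [hW h.2, pEx3, pairChannel, if_pos h]
      have : (1 / 3 * (1 / 2) / (1 / 3 * (1 / 3)) : ℝ) = 3 / 2 := by norm_num
      rw [this, Real.logb_div (by norm_num) (by norm_num), Real.logb_self_eq_one one_lt_two]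
      ring
    · simp [pairChannel, h]
  simp only [mutInf, hterm]
  rw [Finset.sum_comm]
  simp only [← Finset.sum_mul, sum_pairChannel]
  simp
  ring

lemma mutInf_ex3_ge {ε : ℝ} (hε0 : 1 ≤ ε) (hε : ε < 13 / 12) {r : Fin 3 → Finset (Fin 3) → ℝ}
    (hr : IsCondPMF r) (hrw : ∀ x w, 0 < r x w → x ∈ w ∧ IsHyperedgeNS pEx3 fEx3 ε w) :
    Real.logb 2 3 - 1 ≤ mutInf (fun w x => pEx3 x * r x w) := by
  have hX (x : Fin 3) : ∑ w, pEx3 x * r x w = 1 / 3 := by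
    rw [← Finset.mul_sum, (hr x).2, pEx3, mul_one]
  have hq (w : Finset (Fin 3)) (x : Fin 3) : 0 ≤ pEx3 x * r x w :=
    mul_nonneg (by norm_num [pEx3]) ((hr x).1 w)
  have hzero {x : Fin 3} {w : Finset (Fin 3)}
      (h : ¬(x ∈ w ∧ IsHyperedgeNS pEx3 fEx3 ε w)) : pEx3 x * r x w = 0 := by
    rw [((hr x).1 w).antisymm' (not_lt.1 fun h' => h (hrw x w h')), mul_zero]
  have htotal : ∑ w, ∑ x, pEx3 x * r x w = 1 := by
    rw [Finset.sum_comm]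
    simp [hX]
  simp only [mutInf, hX]
  have hL : Real.logb 2 3 - 1 = ∑ w, (∑ x, pEx3 x * r x w) * (Real.logb 2 3 - 1) := by
    rw [← Finset.sum_mul, htotal, one_mul]
  rw [hL]
  refine Finset.sum_le_sum fun w _ => ?_
  by_cases hw : IsHyperedgeNS pEx3 fEx3 ε w
  · refine sum_mul_logb_div_ge (hq w) (w := w) ?_ fun x hx => hzero fun h => hx h.1
    have hne := ((isHyperedgeNS_ex3_iff hε0 hε w).1 hw).2
    simpa [Nat.lt_succ_iff] using (Finset.card_lt_iff_ne_univ w).2 hne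
  · exact sum_mul_logb_div_ge (hq w) (w := ∅) (by simp) fun x _ => hzero fun h => hw h.2

/-- **Example 3, regime `1 ≤ ε < 13/12`**: the hyperedges of `G_ε` are exactly the
singletons and the three two-element subsets (the full set `{1,2,3}` is not a
hyperedge), and `H_{G_ε}(X) = log₂ 3 − 1`. -/
theorem stmt_16 (ε : ℝ) (hε0 : 1 ≤ ε) (hε : ε < 13 / 12) :
    (∀ S : Finset (Fin 3), IsHyperedgeNS pEx3 fEx3 ε S ↔
      ((∃ x, S = {x}) ∨ S = {0, 1} ∨ S = {1, 2} ∨ S = {0, 2})) ∧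
    funcEntropyNS pEx3 fEx3 ε = Real.logb 2 3 - 1 := by
  have hedge := isHyperedgeNS_ex3_iff hε0 hε
  refine ⟨fun S => (hedge S).trans ?_, IsLeast.csInf_eq ⟨?_, ?_⟩⟩
  · revert S
    decide
  · refine ⟨pairChannel, fun x => ⟨fun w => ?_, sum_pairChannel x⟩, fun x w h => ?_,
      mutInf_pairChannel.symm⟩
    · rw [pairChannel]
      positivity
    · rw [pairChannel] at h
      split_ifs at h with hxw
      · refine ⟨hxw.1, (hedge w).2 ⟨⟨x, hxw.1⟩, ?_⟩⟩
        rintro rfl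
        simp at hxw
      · exact absurd h (lt_irrefl _)
  · rintro i ⟨r, hr, hrw, rfl⟩
    exact mutInf_ex3_ge hε0 hε hr hrw
end
end
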